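/- arXiv:1711.11234 — 3 statements merged into one kernel-verified Lean document; each statement's English description precedes it below -/
import Mathlib

section
/- Let g be a root-reductive Lie algebra with splitting maximal toral subalgebra h and Dynkin Borel subalgebra b ⊇ h. Every indecomposable object M of the extended category O-bar satisfies supp(M) ⊆ λ + Λ for some λ ∈ h*, where Λ is the root lattice. In particular, supp(M) is countable and M is countable dimensional. -/
noncomputable section
namespace Paper

variable (K : Type) [Field K] [IsAlgClosed K] [CharZero K]
variable (g : Type) [LieRing g] [LieAlgebra K g]

def adWeightSpace (h : LieSubalgebra K g) (α : Module.Dual K h) : Submodule K g where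
  carrier := {x | ∀ H : h, ⁅(H : g), x⁆ = α H • x}
  add_mem' := by intro a b ha hb H; rw [lie_add, ha H, hb H, smul_add]
  zero_mem' := by intro H; rw [lie_zero, smul_zero]
  smul_mem' := by intro c x hx H; rw [lie_smul, hx H, smul_comm]

def IsRootOf (h : LieSubalgebra K g) (α : Module.Dual K h) : Prop :=
  α ≠ 0 ∧ adWeightSpace K g h α ≠ ⊥

def IsToralIn (s t : LieSubalgebra K g) : Prop :=
  t ≤ s ∧ IsLieAbelian t ∧
    s.toSubmodule ≤ ⨆ α : Module.Dual K t, s.toSubmodule ⊓ adWeightSpace K g t α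

def IsMaxToralIn (s t : LieSubalgebra K g) : Prop :=
  IsToralIn K g s t ∧ ∀ t' : LieSubalgebra K g, IsToralIn K g s t' → t ≤ t' → t' = t

/-- A root-reductive Lie algebra `g` together with a splitting maximal toral subalgebra `h`
and a splitting Borel subalgebra `b ⊇ h` determined by a set `pos` of positive roots. -/
structure Setup where
  /-- the exhausting chain of finite-dimensional reductive subalgebras -/
  F : ℕ → LieSubalgebra K g
  F_mono : Monotone F
  F_exhaust : ∀ x : g, ∃ n, x ∈ F n
  F_findim : ∀ n, FiniteDimensional K (F n)
  /-- each `F n` is reductive: every abelian ideal is central -/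
  F_reductive : ∀ n, ∀ I : LieIdeal K (F n), IsLieAbelian I → I ≤ LieAlgebra.center K (F n)
  /-- the nested chain of Cartan subalgebras witnessing the root inclusions -/
  C : ℕ → LieSubalgebra K g
  C_mono : Monotone C
  C_le : ∀ n, C n ≤ F n
  C_cartan : ∀ n, (LieSubalgebra.comap (F n).incl (C n)).IsCartanSubalgebra
  /-- each inclusion `F n ↪ F (n+1)` is a root inclusion with respect to `C (n+1)`:
  every root space of `F n` relative to `C n` is a root space of `F (n+1)` -/
  C_rootIncl : ∀ n, ∀ α : Module.Dual K (C n), α ≠ 0 →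
    (F n).toSubmodule ⊓ adWeightSpace K g (C n) α ≠ ⊥ →
    ∃ β : Module.Dual K (C (n + 1)),
      (F n).toSubmodule ⊓ adWeightSpace K g (C n) α
        = (F (n + 1)).toSubmodule ⊓ adWeightSpace K g (C (n + 1)) β
  /-- the splitting maximal toral subalgebra -/
  h : LieSubalgebra K g
  h_maxToral : ∀ n, IsMaxToralIn K g (F n) (h ⊓ F n)
  /-- `g` is the direct sum of its `h`-weight spaces -/
  h_indep : iSupIndep fun α : Module.Dual K h => adWeightSpace K g h α
  h_span : (⨆ α : Module.Dual K h, adWeightSpace K g h α) = ⊤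
  /-- the set `Δ⁺` of positive roots -/
  pos : Set (Module.Dual K h)
  pos_root : ∀ α ∈ pos, IsRootOf K g h α
  pos_add : ∀ α ∈ pos, ∀ β ∈ pos, IsRootOf K g h (α + β) → α + β ∈ pos
  pos_polar : ∀ α : Module.Dual K h, IsRootOf K g h α → (α ∈ pos ↔ ¬(-α ∈ pos))
  neg_add : ∀ α β : Module.Dual K h, IsRootOf K g h α → IsRootOf K g h β →
    α ∉ pos → β ∉ pos → IsRootOf K g h (α + β) → α + β ∉ pos
  /-- the splitting Borel subalgebra -/
  b : LieSubalgebra K g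
  b_eq : b.toSubmodule = h.toSubmodule ⊔ ⨆ α ∈ pos, adWeightSpace K g h α


variable {K g}

namespace Setup

variable (S : Setup K g)

/-- `h ∩ g_n`. -/
def hn (n : ℕ) : LieSubalgebra K g := S.h ⊓ S.F n

/-- restriction of a functional on `h` to `h ∩ g_n`. -/
def resDual (n : ℕ) (lam : Module.Dual K S.h) : Module.Dual K (S.hn n) :=
  lam.comp (LieSubalgebra.inclusion (inf_le_left : S.hn n ≤ S.h)).toLinearMap

/-- the `α`-root space of `g_n` relative to `h ∩ g_n`. -/
def rootSpaceN (n : ℕ) (α : Module.Dual K (S.hn n)) : Submodule K g :=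
  (S.F n).toSubmodule ⊓ adWeightSpace K g (S.hn n) α

/-- the set of `b`-positive roots of `g_n`. -/
def posRootsN (n : ℕ) : Set (Module.Dual K (S.hn n)) :=
  {α | α ≠ 0 ∧ S.rootSpaceN n α ≠ ⊥ ∧ S.rootSpaceN n α ≤ S.b.toSubmodule}

/-- `ρ_n`, the half sum of the positive roots of `g_n` with respect to `b ∩ g_n`. -/
def rhoN (n : ℕ) : Module.Dual K (S.hn n) :=
  (2 : K)⁻¹ • ∑ᶠ α ∈ S.posRootsN n, α

/-- `α` is a simple `b`-positive root: it is positive and cannot be written as a sum of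
two or more positive roots. -/
def IsSimpleRoot (α : Module.Dual K S.h) : Prop :=
  α ∈ S.pos ∧ ¬∃ s : Multiset (Module.Dual K S.h),
    2 ≤ Multiset.card s ∧ (∀ β ∈ s, β ∈ S.pos) ∧ s.sum = α

/-- `b` is a Dynkin Borel subalgebra: it is generated, as a Lie subalgebra, by `h` together
with the simple root spaces. -/
def IsDynkin : Prop :=
  S.b = LieSubalgebra.lieSpan K g
    ((S.h : Set g) ∪ ⋃ α ∈ {α | S.IsSimpleRoot α}, (adWeightSpace K g S.h α : Set g))

/-- the partial order `≼` on `h^*`: `lam ≼ mu` iff `mu - lam` is a `ℤ≥0`-linear combination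
of positive roots. -/
def wle (lam mu : Module.Dual K S.h) : Prop :=
  ∃ s : Multiset (Module.Dual K S.h), (∀ β ∈ s, β ∈ S.pos) ∧ mu - lam = s.sum

/-- `g` is locally semisimple: each `g_n` is a semisimple Lie algebra. -/
def IsLocallySemisimple : Prop := ∀ n, LieAlgebra.IsSemisimple K (S.F n)

end Setup


/-- the universal enveloping algebra of `g`. -/
abbrev Env (K g : Type) [Field K] [LieRing g] [LieAlgebra K g] : Type :=
  UniversalEnvelopingAlgebra K g

namespace Setup

variable {K : Type} [Field K] [IsAlgClosed K] [CharZero K]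
variable {g : Type} [LieRing g] [LieAlgebra K g]
variable (S : Setup K g)

/-- the nilpotent radical `n⁺ = ⨁_{α ∈ Δ⁺} g^α` of `b`, as a subspace of `g`. -/
def nplus : Submodule K g := ⨆ α ∈ S.pos, adWeightSpace K g S.h α

/-- the left ideal of `U(g)` generated by `n⁺` and the elements `H - lam(H)`, `H ∈ h`. -/
def vermaIdeal (lam : Module.Dual K S.h) : Submodule (Env K g) (Env K g) :=
  Submodule.span (Env K g)
    ((UniversalEnvelopingAlgebra.ι K '' (S.nplus : Set g)) ∪
      Set.range fun H : S.h =>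
        UniversalEnvelopingAlgebra.ι K (H : g) - algebraMap K (Env K g) (lam H))

/-- the Verma module `M(lam) = U(g)/I`. -/
abbrev Verma (lam : Module.Dual K S.h) : Type := Env K g ⧸ S.vermaIdeal lam

/-- the maximal proper submodule of the Verma module `M(lam)`,
i.e. the sum of all proper submodules. -/
def maxSub (lam : Module.Dual K S.h) : Submodule (Env K g) (S.Verma lam) :=
  sSup {N : Submodule (Env K g) (S.Verma lam) | N ≠ ⊤}

/-- the simple module `L(lam)`, the unique simple quotient of `M(lam)`. -/
abbrev SimpleL (lam : Module.Dual K S.h) : Type := S.Verma lam ⧸ S.maxSub lam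

/-- `H` is the coroot `h_α` of the root `α`:  `α(H) = 2` and `H ∈ [g^α, g^{-α}]`. -/
def IsCoroot (α : Module.Dual K S.h) (H : S.h) : Prop :=
  α H = 2 ∧ ∃ x ∈ adWeightSpace K g S.h α, ∃ y ∈ adWeightSpace K g S.h (-α),
    (H : g) = ⁅x, y⁆

/-- the dot-reflection `s_α · mu = mu - (mu + ρ)(h_α) α` associated to a root `α`
with coroot `Hα`, relative to the half sum `ρ` of positive roots. -/
def dotReflect (ρ α : Module.Dual K S.h) (Hα : S.h) (mu : Module.Dual K S.h) :
    Module.Dual K S.h :=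
  mu - ((mu + ρ) Hα) • α

/-- `ρ` is the global half sum of positive roots: its restriction to each `h ∩ g_n`
is the half sum `ρ_n` of positive roots of `g_n`. -/
def IsGlobalRho (ρ : Module.Dual K S.h) : Prop := ∀ n : ℕ, S.resDual n ρ = S.rhoN n

/-- `lam` is strongly linked to `mu` (relative to `ρ`). -/
inductive StronglyLinked (ρ : Module.Dual K S.h) :
    Module.Dual K S.h → Module.Dual K S.h → Prop
  | refl (mu : Module.Dual K S.h) : StronglyLinked ρ mu mu
  | step {lam mu : Module.Dual K S.h} (α : Module.Dual K S.h) (Hα : S.h) :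
      α ∈ S.pos → S.IsCoroot α Hα →
      S.wle (S.dotReflect ρ α Hα mu) mu →
      StronglyLinked ρ lam (S.dotReflect ρ α Hα mu) →
      StronglyLinked ρ lam mu

/-- `lam` is antidominant: `(lam + ρ)(h_α)` is not a positive integer
for any positive root `α`. -/
def IsAntidominant (ρ lam : Module.Dual K S.h) : Prop :=
  ∀ α ∈ S.pos, ∀ Hα : S.h, S.IsCoroot α Hα → ¬∃ k : ℕ, 0 < k ∧ (lam + ρ) Hα = (k : K)

/-- `lam` is almost antidominant: `(lam + ρ)(h_α)` is a positive integer
for only finitely many positive roots `α`. -/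
def IsAlmostAntidominant (ρ lam : Module.Dual K S.h) : Prop :=
  {α | α ∈ S.pos ∧ ∃ Hα : S.h, S.IsCoroot α Hα ∧
    ∃ k : ℕ, 0 < k ∧ (lam + ρ) Hα = (k : K)}.Finite

end Setup

namespace Setup

variable {K : Type} [Field K] [IsAlgClosed K] [CharZero K]
variable {g : Type} [LieRing g] [LieAlgebra K g]
variable (S : Setup K g)

/-- the reflection `s_α : mu ↦ mu - mu(h_α) α`, as a linear map on `h^*`. -/
def reflectionMap (α : Module.Dual K S.h) (Hα : S.h) :
    Module.Dual K S.h →ₗ[K] Module.Dual K S.h where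
  toFun mu := mu - mu Hα • α
  map_add' mu ν := by
    simp only [LinearMap.add_apply, add_smul]
    abel
  map_smul' c mu := by
    simp only [LinearMap.smul_apply, RingHom.id_apply, smul_sub, smul_smul, smul_eq_mul]

/-- the reflection `s_α` associated to a root `α` with coroot `Hα`,
as a linear automorphism of `h^*`. -/
def reflection (α : Module.Dual K S.h) (Hα : S.h) (h2 : α Hα = 2) :
    Module.Dual K S.h ≃ₗ[K] Module.Dual K S.h :=
  LinearEquiv.ofInvolutive (S.reflectionMap α Hα) (by
    intro mu
    show S.reflectionMap α Hα (mu - mu Hα • α) = mu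
    show (mu - mu Hα • α) - ((mu - mu Hα • α) Hα) • α = mu
    rw [LinearMap.sub_apply, LinearMap.smul_apply, h2, smul_eq_mul]
    module)

/-- the Weyl group of `g`, realized as the group of linear automorphisms of `h^*`
generated by the reflections in the roots. -/
def weylGroup : Subgroup (Module.Dual K S.h ≃ₗ[K] Module.Dual K S.h) :=
  Subgroup.closure
    {w | ∃ (α : Module.Dual K S.h) (Hα : S.h) (hc : S.IsCoroot α Hα),
      IsRootOf K g S.h α ∧ w = S.reflection α Hα hc.1}

/-- the dot action `w · mu = w(mu + ρ) - ρ`. -/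
def dotAct (ρ : Module.Dual K S.h) (w : Module.Dual K S.h ≃ₗ[K] Module.Dual K S.h)
    (mu : Module.Dual K S.h) : Module.Dual K S.h :=
  w (mu + ρ) - ρ

/-- the root lattice `Λ`, the `ℤ`-span of the roots in `h^*`. -/
def rootLattice : Submodule ℤ (Module.Dual K S.h) :=
  Submodule.span ℤ {α : Module.Dual K S.h | IsRootOf K g S.h α}

end Setup

variable {K : Type} [Field K] [IsAlgClosed K] [CharZero K]
variable {g : Type} [LieRing g] [LieAlgebra K g]

lemma env_smul_comm {M : Type} [AddCommGroup M] [Module K M] [Module (Env K g) M]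
    [IsScalarTower K (Env K g) M] (c : K) (r : Env K g) (m : M) :
    r • (c • m) = c • (r • m) := by
  rw [← algebraMap_smul (Env K g) c m, ← mul_smul, ← Algebra.commutes, mul_smul,
    algebraMap_smul]

namespace Setup

variable (S : Setup K g)

section Modules

variable (M : Type) [AddCommGroup M] [Module K M] [Module (Env K g) M]
  [IsScalarTower K (Env K g) M]

/-- the `lam`-weight space of a `U(g)`-module `M`. -/
def wtSpace (lam : Module.Dual K S.h) : Submodule K M where
  carrier := {m | ∀ H : S.h, UniversalEnvelopingAlgebra.ι K (H : g) • m = lam H • m}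
  add_mem' := by
    intro a b ha hb H
    rw [smul_add, ha H, hb H, smul_add]
  zero_mem' := by
    intro H
    rw [smul_zero, smul_zero]
  smul_mem' := by
    intro c x hx H
    rw [env_smul_comm, hx H, smul_comm]

/-- the support of `M`: the set of `h`-weights of `M`. -/
def support : Set (Module.Dual K S.h) := {lam | S.wtSpace M lam ≠ ⊥}

/-- `M` is an object of the extended category `O-bar`:  it is an `h`-weight module with
finite-dimensional weight spaces and `U(n⁺) ⬝ v` is finite dimensional for every `v ∈ M`. -/
structure InO : Prop where
  indep : iSupIndep fun lam : Module.Dual K S.h => S.wtSpace M lam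
  span : (⨆ lam : Module.Dual K S.h, S.wtSpace M lam) = ⊤
  finite : ∀ lam : Module.Dual K S.h, FiniteDimensional K (S.wtSpace M lam)
  locFin : ∀ v : M, ∃ N : Submodule K M, FiniteDimensional K N ∧ v ∈ N ∧
    ∀ x ∈ S.nplus, ∀ m ∈ N, UniversalEnvelopingAlgebra.ι K x • m ∈ N

end Modules

end Setup

/-- a `U(g)`-module is indecomposable if it is nonzero and is not the direct sum of two
nonzero submodules. -/
def Indecomposable (M : Type) [AddCommGroup M] [Module (Env K g) M] : Prop :=
  (⊤ : Submodule (Env K g) M) ≠ ⊥ ∧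
    ∀ N₁ N₂ : Submodule (Env K g) M, IsCompl N₁ N₂ → N₁ = ⊥ ∨ N₂ = ⊥

/-- the subquotient `N₂ / N₁` of a pair of submodules. -/
abbrev subQuot {M : Type} [AddCommGroup M] [Module (Env K g) M]
    (N₁ N₂ : Submodule (Env K g) M) : Type :=
  N₂ ⧸ (N₁.comap N₂.subtype)

/-- Countable sums of finite-dimensional subspaces have countable dimension. -/
lemma rank_le_aleph0_of_biSup_eq_top {V ι : Type} [AddCommGroup V] [Module K V]
    (W : ι → Submodule K V) [∀ i, FiniteDimensional K (W i)] {s : Set ι} (hs : s.Countable)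
    (hW : ⨆ i ∈ s, W i = ⊤) : Module.rank K V ≤ Cardinal.aleph0 := by
  have hfg (i : ι) : (W i).FG := Module.Finite.iff_fg.mp inferInstance
  choose t ht using hfg
  have hspan : Submodule.span K (⋃ i ∈ s, (t i : Set V)) = ⊤ := by
    simp only [Submodule.span_iUnion, ht, hW]
  have hcard : (⋃ i ∈ s, (t i : Set V)).Countable :=
    hs.biUnion fun i _ => (t i).countable_toSet
  rw [← rank_top, ← hspan]
  exact (rank_span_le _).trans (Cardinal.le_aleph0_iff_set_countable.mpr hcard)

lemma adjoin_range_env_ι :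
    Algebra.adjoin K (Set.range (UniversalEnvelopingAlgebra.ι K : g → Env K g)) = ⊤ := by
  have hsurj : Function.Surjective (UniversalEnvelopingAlgebra.mkAlgHom K g) :=
    RingCon.mkₐ_surjective _
  rw [← (AlgHom.range_eq_top _).mpr hsurj, ← Algebra.map_top, ← TensorAlgebra.adjoin_range_ι,
    AlgHom.map_adjoin, ← Set.range_comp]
  rfl

/-- A subspace stable under the action of `g` is a `U(g)`-submodule. -/
def submoduleOfStable {M : Type} [AddCommGroup M] [Module K M] [Module (Env K g) M]
    [IsScalarTower K (Env K g) M] (N : Submodule K M)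
    (hN : ∀ (x : g), ∀ m ∈ N, UniversalEnvelopingAlgebra.ι K x • m ∈ N) :
    Submodule (Env K g) M where
  toAddSubmonoid := N.toAddSubmonoid
  smul_mem' := by
    intro u
    have hu : u ∈ Algebra.adjoin K (Set.range (UniversalEnvelopingAlgebra.ι K : g → Env K g)) :=
      adjoin_range_env_ι (K := K) (g := g) ▸ Algebra.mem_top
    induction hu using Algebra.adjoin_induction with
    | mem u hu =>
      obtain ⟨x, rfl⟩ := hu
      exact hN x
    | algebraMap c =>
      intro m hm
      rw [algebraMap_smul]
      exact N.smul_mem c hm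
    | add u v _ _ hu hv =>
      intro m hm
      rw [add_smul]
      exact N.add_mem (hu hm) (hv hm)
    | mul u v _ _ hu hv =>
      intro m hm
      rw [mul_smul]
      exact hu (hv hm)

namespace Setup

variable (S : Setup K g)

lemma mem_rootLattice_of_adWeightSpace_ne_bot {α : Module.Dual K S.h}
    (hα : adWeightSpace K g S.h α ≠ ⊥) : α ∈ S.rootLattice := by
  by_cases h0 : α = 0
  · exact h0 ▸ S.rootLattice.zero_mem
  · exact Submodule.subset_span ⟨h0, hα⟩

lemma rank_le_aleph0 (S : Setup K g) : Module.rank K g ≤ Cardinal.aleph0 := by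
  have (n : ℕ) : FiniteDimensional K (S.F n).toSubmodule := S.F_findim n
  refine rank_le_aleph0_of_biSup_eq_top (fun n => (S.F n).toSubmodule) Set.countable_univ ?_
  refine eq_top_iff.mpr fun x _ => ?_
  obtain ⟨n, hn⟩ := S.F_exhaust x
  exact Submodule.mem_iSup_of_mem n (Submodule.mem_iSup_of_mem trivial hn)

lemma countable_roots : {α : Module.Dual K S.h | IsRootOf K g S.h α}.Countable := by
  have hcard := S.h_indep.subtype_ne_bot_le_rank
  rw [Cardinal.lift_id, Cardinal.lift_id] at hcard
  have hne : {α : Module.Dual K S.h | adWeightSpace K g S.h α ≠ ⊥}.Countable :=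
    Cardinal.le_aleph0_iff_set_countable.mp (hcard.trans S.rank_le_aleph0)
  exact hne.mono fun _ hα => hα.2

lemma countable_rootLattice : (S.rootLattice : Set (Module.Dual K S.h)).Countable := by
  have := S.countable_roots.to_subtype
  have hspan : Countable (Submodule.span ℤ (Set.range
      ((↑) : {α : Module.Dual K S.h | IsRootOf K g S.h α} → Module.Dual K S.h))) := inferInstance
  rw [Subtype.range_coe] at hspan
  exact Set.countable_coe_iff.mp hspan

variable {M : Type} [AddCommGroup M] [Module K M] [Module (Env K g) M]
  [IsScalarTower K (Env K g) M]

lemma ι_smul_mem_wtSpace {α lam : Module.Dual K S.h} {x : g} {m : M}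
    (hx : x ∈ adWeightSpace K g S.h α) (hm : m ∈ S.wtSpace M lam) :
    UniversalEnvelopingAlgebra.ι K x • m ∈ S.wtSpace M (lam + α) := by
  intro H
  have hbr : UniversalEnvelopingAlgebra.ι K (H : g) * UniversalEnvelopingAlgebra.ι K x =
      α H • UniversalEnvelopingAlgebra.ι K x +
        UniversalEnvelopingAlgebra.ι K x * UniversalEnvelopingAlgebra.ι K (H : g) := by
    letI : LieRing (Env K g) := LieRing.ofAssociativeRing
    rw [← sub_eq_iff_eq_add, ← LieRing.of_associative_ring_bracket, ← LieHom.map_lie, hx H,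
      map_smul]
  rw [← mul_smul, hbr, add_smul, mul_smul, hm H, smul_assoc, env_smul_comm, LinearMap.add_apply,
    add_smul, add_comm]

lemma ι_smul_mem_biSup_wtSpace {T : Set (Module.Dual K S.h)}
    (hT : ∀ lam ∈ T, ∀ α ∈ S.rootLattice, lam + α ∈ T) (x : g) {m : M}
    (hm : m ∈ ⨆ lam ∈ T, S.wtSpace M lam) :
    UniversalEnvelopingAlgebra.ι K x • m ∈ ⨆ lam ∈ T, S.wtSpace M lam := by
  have hx : x ∈ ⨆ α : Module.Dual K S.h, adWeightSpace K g S.h α := S.h_span ▸ Submodule.mem_top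
  induction hx using Submodule.iSup_induction' with
  | zero => simp
  | add x y _ _ hx hy =>
    rw [map_add, add_smul]
    exact add_mem hx hy
  | mem α x hx =>
    by_cases hα : adWeightSpace K g S.h α = ⊥
    · rw [hα, Submodule.mem_bot] at hx
      simp [hx]
    have hle : ⨆ lam ∈ T, S.wtSpace M lam ≤ (⨆ lam ∈ T, S.wtSpace M lam).comap
        (Algebra.lsmul K K M (UniversalEnvelopingAlgebra.ι K x)) := by
      refine iSup₂_le fun lam hlam m hm => ?_
      exact Submodule.mem_iSup_of_mem (lam + α) <| Submodule.mem_iSup_of_mem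
        (hT lam hlam α (S.mem_rootLattice_of_adWeightSpace_ne_bot hα))
        (S.ι_smul_mem_wtSpace hx hm)
    exact hle hm

/-- The sum of the weight spaces with weights in a `Λ`-stable set, as a `U(g)`-submodule. -/
def wtSubmodule (M : Type) [AddCommGroup M] [Module K M] [Module (Env K g) M]
    [IsScalarTower K (Env K g) M] (T : Set (Module.Dual K S.h))
    (hT : ∀ lam ∈ T, ∀ α ∈ S.rootLattice, lam + α ∈ T) : Submodule (Env K g) M :=
  submoduleOfStable (⨆ lam ∈ T, S.wtSpace M lam) fun x _ hm =>
    S.ι_smul_mem_biSup_wtSpace hT x hm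

variable {S}

lemma mem_wtSubmodule {T : Set (Module.Dual K S.h)}
    {hT : ∀ lam ∈ T, ∀ α ∈ S.rootLattice, lam + α ∈ T} {m : M} :
    m ∈ S.wtSubmodule M T hT ↔ m ∈ ⨆ lam ∈ T, S.wtSpace M lam :=
  Iff.rfl

lemma wtSubmodule_eq_bot {T : Set (Module.Dual K S.h)}
    {hT : ∀ lam ∈ T, ∀ α ∈ S.rootLattice, lam + α ∈ T} (h : S.wtSubmodule M T hT = ⊥)
    {lam : Module.Dual K S.h} (hlam : lam ∈ T) : S.wtSpace M lam = ⊥ := by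
  refine eq_bot_iff.mpr fun m hm => ?_
  have hmem : m ∈ S.wtSubmodule M T hT :=
    mem_wtSubmodule.mpr (Submodule.mem_iSup_of_mem lam (Submodule.mem_iSup_of_mem hlam hm))
  rw [h] at hmem
  exact hmem

lemma InO.isCompl_wtSubmodule (hM : S.InO M) {T : Set (Module.Dual K S.h)}
    (hT : ∀ lam ∈ T, ∀ α ∈ S.rootLattice, lam + α ∈ T)
    (hTc : ∀ lam ∈ Tᶜ, ∀ α ∈ S.rootLattice, lam + α ∈ Tᶜ) :
    IsCompl (S.wtSubmodule M T hT) (S.wtSubmodule M Tᶜ hTc) := by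
  constructor
  · rw [Submodule.disjoint_def]
    intro m h₁ h₂
    exact Submodule.disjoint_def.mp (hM.indep.disjoint_biSup_biSup disjoint_compl_right) m h₁ h₂
  · rw [codisjoint_iff, eq_top_iff]
    intro m _
    have hm : m ∈ (⨆ lam ∈ T, S.wtSpace M lam) ⊔ ⨆ lam ∈ Tᶜ, S.wtSpace M lam := by
      have hspan := hM.span
      rw [iSup_split _ (· ∈ T)] at hspan
      exact hspan ▸ Submodule.mem_top
    obtain ⟨a, ha, b, hb, rfl⟩ := Submodule.mem_sup.mp hm
    exact add_mem (Submodule.mem_sup_left (mem_wtSubmodule.mpr ha))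
      (Submodule.mem_sup_right (mem_wtSubmodule.mpr hb))

lemma InO.biSup_support (hM : S.InO M) : ⨆ lam ∈ S.support M, S.wtSpace M lam = ⊤ := by
  rw [← hM.span]
  exact (iSup_subtype'' _ _).symm.trans (iSup_ne_bot_subtype _)

lemma InO.exists_support_sub_mem_rootLattice (hM : S.InO M)
    (hInd : Indecomposable (K := K) (g := g) M) :
    ∃ lam₀ : Module.Dual K S.h, ∀ mu ∈ S.support M, mu - lam₀ ∈ S.rootLattice := by
  obtain ⟨lam₀, hlam₀⟩ : (S.support M).Nonempty := by
    by_contra hempty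
    have htop := hM.biSup_support
    rw [Set.not_nonempty_iff_eq_empty.mp hempty] at htop
    refine hInd.1 (eq_bot_iff.mpr fun m _ => ?_)
    have hm : m ∈ (⊤ : Submodule K M) := Submodule.mem_top
    rw [← htop] at hm
    simpa using hm
  refine ⟨lam₀, fun mu hmu => ?_⟩
  have hshift (lam α : Module.Dual K S.h) (hα : α ∈ S.rootLattice) :
      lam + α - lam₀ ∈ S.rootLattice ↔ lam - lam₀ ∈ S.rootLattice := by
    rw [add_sub_right_comm]
    exact S.rootLattice.add_mem_iff_left hα
  have hcompl := hM.isCompl_wtSubmodule (T := {lam | lam - lam₀ ∈ S.rootLattice})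
    (fun lam hlam α hα => (hshift lam α hα).mpr hlam)
    (fun lam hlam α hα h => hlam ((hshift lam α hα).mp h))
  rcases hInd.2 _ _ hcompl with hbot | hbot
  · refine absurd (wtSubmodule_eq_bot hbot (lam := lam₀) ?_) hlam₀
    simp
  · by_contra hnot
    exact hmu (wtSubmodule_eq_bot hbot hnot)

end Setup

/-- Every indecomposable object `M` of `O-bar` satisfies
`supp(M) ⊆ lam₀ + Λ` for some `lam₀`, where `Λ` is the root lattice; in particular
`supp(M)` is countable and `M` is countable dimensional. -/
theorem indecomposable_support_subset_coset
    (K : Type) [Field K] [IsAlgClosed K] [CharZero K]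
    (g : Type) [LieRing g] [LieAlgebra K g] (S : Setup K g) (hDynkin : S.IsDynkin)
    (M : Type) [AddCommGroup M] [Module K M] [Module (Env K g) M]
    [IsScalarTower K (Env K g) M]
    (hM : S.InO M) (hInd : Indecomposable (K := K) (g := g) M) :
    (∃ lam₀ : Module.Dual K S.h, ∀ mu ∈ S.support M, mu - lam₀ ∈ S.rootLattice) ∧
      (S.support M).Countable ∧ Module.rank K M ≤ Cardinal.aleph0 := by
  obtain ⟨lam₀, hlam₀⟩ := hM.exists_support_sub_mem_rootLattice hInd
  have hcount : (S.support M).Countable :=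
    (S.countable_rootLattice.preimage (sub_left_injective (b := lam₀))).mono hlam₀
  have := hM.finite
  exact ⟨⟨lam₀, hlam₀⟩, hcount, rank_le_aleph0_of_biSup_eq_top _ hcount hM.biSup_support⟩

end Paper
end
end

section
/- Let g be a root-reductive Lie algebra with splitting maximal toral subalgebra h and Dynkin Borel subalgebra b ⊇ h. Every object M of the extended category O-bar is a direct sum of indecomposable objects of O-bar. -/
noncomputable section
namespace Paper

variable (K : Type) [Field K] [IsAlgClosed K] [CharZero K]
variable (g : Type) [LieRing g] [LieAlgebra K g]

variable {K g}

variable {K : Type} [Field K] [IsAlgClosed K] [CharZero K]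
variable {g : Type} [LieRing g] [LieAlgebra K g]

section CommutingIdempotents

variable {R : Type} [Ring R] {M : Type} [AddCommGroup M] [Module R M]

/-- the joint eigenspace, with eigenvalues `1` on `χ` and `0` off `χ`, of a set `B` of
endomorphisms of `M`. -/
def jointEigenspace (B : Set (Module.End R M)) (χ : Set B) : Submodule R M where
  carrier := {m | ∀ e : B, (e ∈ χ → e.1 m = m) ∧ (e ∉ χ → e.1 m = 0)}
  add_mem' := by
    intro a b ha hb e
    refine ⟨fun h => ?_, fun h => ?_⟩
    · rw [map_add, (ha e).1 h, (hb e).1 h]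
    · rw [map_add, (ha e).2 h, (hb e).2 h, add_zero]
  zero_mem' := fun e => ⟨fun _ => map_zero _, fun _ => map_zero _⟩
  smul_mem' := by
    intro c x hx e
    refine ⟨fun h => ?_, fun h => ?_⟩
    · rw [map_smul, (hx e).1 h]
    · rw [map_smul, (hx e).2 h, smul_zero]

/-- `B` is a maximal set of pairwise commuting idempotent endomorphisms. -/
structure IsMaximalCommutingIdempotents (B : Set (Module.End R M)) : Prop where
  idem : ∀ e ∈ B, e * e = e
  comm : ∀ e ∈ B, ∀ f ∈ B, e * f = f * e
  mem_of_comm : ∀ f : Module.End R M, f * f = f → (∀ e ∈ B, f * e = e * f) → f ∈ B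

variable (R M) in
lemma exists_isMaximalCommutingIdempotents :
    ∃ B : Set (Module.End R M), IsMaximalCommutingIdempotents B := by
  obtain ⟨B, hB⟩ := zorn_subset
    {B : Set (Module.End R M) | (∀ e ∈ B, e * e = e) ∧ ∀ e ∈ B, ∀ f ∈ B, e * f = f * e} (by
      intro c hc hchain
      refine ⟨⋃₀ c, ⟨?_, ?_⟩, fun s hs => Set.subset_sUnion_of_mem hs⟩
      · rintro e ⟨s, hs, he⟩
        exact (hc hs).1 e he
      · rintro e ⟨s, hs, he⟩ f ⟨t, ht, hf⟩
        rcases hchain.total hs ht with h | h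
        · exact (hc ht).2 e (h he) f hf
        · exact (hc hs).2 e he f (h hf))
  refine ⟨B, hB.prop.1, hB.prop.2, fun f hf hcomm => ?_⟩
  refine hB.le_of_ge (y := insert f B) ⟨?_, ?_⟩ (Set.subset_insert f B) (Set.mem_insert f B)
  · rintro e (rfl | he)
    · exact hf
    · exact hB.prop.1 e he
  · rintro e (rfl | he) e' (rfl | he')
    · rfl
    · exact hcomm e' he'
    · exact (hcomm e he).symm
    · exact hB.prop.2 e he e' he'

namespace IsMaximalCommutingIdempotents

variable {B : Set (Module.End R M)}

lemma one_sub_mem (hB : IsMaximalCommutingIdempotents B) {e : Module.End R M} (he : e ∈ B) :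
    1 - e ∈ B :=
  hB.mem_of_comm _ (IsIdempotentElem.one_sub (hB.idem e he)) fun f hf => by
    rw [sub_mul, mul_sub, one_mul, mul_one, hB.comm e he f hf]

lemma mul_mem (hB : IsMaximalCommutingIdempotents B) {e f : Module.End R M} (he : e ∈ B)
    (hf : f ∈ B) : e * f ∈ B :=
  hB.mem_of_comm _
    (IsIdempotentElem.mul_of_commute (hB.comm e he f hf) (hB.idem e he) (hB.idem f hf))
    fun f' hf' => Commute.mul_left (hB.comm e he f' hf') (hB.comm f hf f' hf')

lemma one_mem (hB : IsMaximalCommutingIdempotents B) : (1 : Module.End R M) ∈ B :=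
  hB.mem_of_comm _ (one_mul 1) fun f _ => by rw [one_mul, mul_one]

lemma exists_separating (hB : IsMaximalCommutingIdempotents B) (χ : Set B) {m : M}
    (hm : m ∈ ⨆ χ', ⨆ (_ : χ' ≠ χ), jointEigenspace B χ') :
    ∃ p ∈ B, (∀ x ∈ jointEigenspace B χ, p x = x) ∧ p m = 0 := by
  rw [iSup_subtype'] at hm
  induction hm using Submodule.iSup_induction' with
  | mem i x hx =>
    obtain ⟨χ', hne⟩ := i
    obtain ⟨e, he⟩ : ∃ e : B, ¬(e ∈ χ' ↔ e ∈ χ) := by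
      by_contra! h
      exact hne (Set.ext h)
    by_cases h : e ∈ χ
    · have h' : e ∉ χ' := fun h' => he ⟨fun _ => h, fun _ => h'⟩
      exact ⟨e, e.2, fun y hy => (hy e).1 h, (hx e).2 h'⟩
    · have h' : e ∈ χ' := by
        by_contra h'
        exact he ⟨fun a => absurd a h', fun a => absurd a h⟩
      refine ⟨1 - e, hB.one_sub_mem e.2, fun y hy => ?_, ?_⟩
      · rw [LinearMap.sub_apply, (hy e).2 h, sub_zero, Module.End.one_apply]
      · rw [LinearMap.sub_apply, (hx e).1 h', Module.End.one_apply, sub_self]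
  | zero => exact ⟨1, hB.one_mem, fun _ _ => rfl, rfl⟩
  | add x y _ _ hx hy =>
    obtain ⟨p, hp, hp1, hp0⟩ := hx
    obtain ⟨q, hq, hq1, hq0⟩ := hy
    refine ⟨p * q, hB.mul_mem hp hq, fun z hz => ?_, ?_⟩
    · rw [Module.End.mul_apply, hq1 z hz, hp1 z hz]
    · rw [map_add, Module.End.mul_apply p q y, hq0, hB.comm p hp q hq, Module.End.mul_apply, hp0]
      simp

lemma iSupIndep_jointEigenspace (hB : IsMaximalCommutingIdempotents B) :
    iSupIndep (jointEigenspace B) := by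
  intro χ
  rw [Submodule.disjoint_def]
  intro x hx hx'
  obtain ⟨p, -, hp1, hp0⟩ := hB.exists_separating χ hx'
  rw [← hp1 x hx, hp0]

lemma le_iSup_jointEigenspace (hB : IsMaximalCommutingIdempotents B)
    {k : Type} [Field k] [Algebra k R] [Module k M] [IsScalarTower k R M]
    (V : Submodule k M) [FiniteDimensional k V] (hV : ∀ e ∈ B, ∀ v ∈ V, e v ∈ V) :
    V ≤ (⨆ χ, jointEigenspace B χ).restrictScalars k := by
  induction hn : Module.finrank k V using Nat.strong_induction_on generalizing V with
  | _ n ih =>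
  by_cases h : ∀ e ∈ B, (∀ v ∈ V, e v = v) ∨ ∀ v ∈ V, e v = 0
  · intro v hv
    refine Submodule.mem_iSup_of_mem (p := jointEigenspace B) {e : B | ∀ v ∈ V, e.1 v = v} ?_
    exact fun e => ⟨fun he => he v hv, fun he => ((h e e.2).resolve_left he) v hv⟩
  push Not at h
  obtain ⟨e, he, ⟨v₁, hv₁, hne₁⟩, v₀, hv₀, hne₀⟩ := h
  have key : ∀ f ∈ B, (∃ v ∈ V, f v ≠ 0) →
      V ⊓ LinearMap.ker (f.restrictScalars k) ≤
        (⨆ χ, jointEigenspace B χ).restrictScalars k := by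
    rintro f hf ⟨v, hv, hne⟩
    have hlt : V ⊓ LinearMap.ker (f.restrictScalars k) < V := by
      refine lt_of_le_of_ne inf_le_left fun heq => hne ?_
      rw [← heq] at hv
      exact hv.2
    have : FiniteDimensional k ↥(V ⊓ LinearMap.ker (f.restrictScalars k)) :=
      Submodule.finiteDimensional_of_le inf_le_left
    refine ih _ ?_ _ (fun e' he' w hw => ⟨hV e' he' w hw.1, ?_⟩) rfl
    · rw [← hn]
      exact Submodule.finrank_lt_finrank_of_lt hlt
    · have hw0 : f w = 0 := hw.2
      change (f * e') w = 0
      rw [hB.comm f hf e' he', Module.End.mul_apply, hw0, map_zero]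
  intro v hv
  have hidem : e (e v) = e v := LinearMap.congr_fun (hB.idem e he) v
  have h0 := key e he ⟨v₀, hv₀, hne₀⟩
    (show v - e v ∈ _ from ⟨V.sub_mem hv (hV e he v hv), by
      change e (v - e v) = 0
      rw [map_sub, hidem, sub_self]⟩)
  have h1 := key (1 - e) (hB.one_sub_mem he)
    ⟨v₁, hv₁, fun h => hne₁ (sub_eq_zero.1 h).symm⟩
    (show e v ∈ _ from ⟨hV e he v hv, by
      change e v - e (e v) = 0
      rw [hidem, sub_self]⟩)
  simpa using Submodule.add_mem _ h0 h1

lemma eq_bot_or_eq_bot_of_isCompl (hB : IsMaximalCommutingIdempotents B)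
    (htop : ⨆ χ, jointEigenspace B χ = ⊤) (χ : Set B)
    {N₁ N₂ : Submodule R (jointEigenspace B χ)} (hN : IsCompl N₁ N₂) : N₁ = ⊥ ∨ N₂ = ⊥ := by
  let Q := ⨆ χ', ⨆ (_ : χ' ≠ χ), jointEigenspace B χ'
  have hPQ : IsCompl (jointEigenspace B χ) Q := by
    refine ⟨hB.iSupIndep_jointEigenspace χ, codisjoint_iff.2 (top_le_iff.1 ?_)⟩
    rw [← htop]
    refine iSup_le fun χ' => ?_
    by_cases h : χ' = χ
    · exact h ▸ le_sup_left
    · exact le_sup_of_le_right (le_iSup₂_of_le χ' h le_rfl)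
  have hQinv : ∀ e ∈ B, ∀ x ∈ Q, e x ∈ Q := by
    intro e he x hx
    have : Q ≤ Q.comap e := by
      refine iSup₂_le fun χ' h y hy => ?_
      have hyQ : y ∈ Q := le_iSup₂_of_le (f := fun χ' (_ : χ' ≠ χ) => jointEigenspace B χ')
        χ' h le_rfl hy
      rw [Submodule.mem_comap]
      by_cases hχ : (⟨e, he⟩ : B) ∈ χ'
      · rwa [(hy ⟨e, he⟩).1 hχ]
      · rw [(hy ⟨e, he⟩).2 hχ]
        exact Q.zero_mem
    exact this hx
  let f : Module.End R M :=
    (jointEigenspace B χ).subtype ∘ₗ N₁.subtype ∘ₗ N₁.projectionOnto N₂ hN ∘ₗ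
      (jointEigenspace B χ).projectionOnto Q hPQ
  have f_P : ∀ x : jointEigenspace B χ,
      f x = ((N₁.projectionOnto N₂ hN x : jointEigenspace B χ) : M) := fun x => by
    simp [f]
  have f_Q : ∀ x ∈ Q, f x = 0 := fun x hx => by
    simp [f, (Submodule.projectionOnto_apply_eq_zero_iff hPQ).2 hx]
  have f_mem : ∀ x, f x ∈ jointEigenspace B χ := fun x => Subtype.property _
  have decomp : ∀ x : M, ∃ y : jointEigenspace B χ, ∃ z ∈ Q, x = y + z := fun x => by
    obtain ⟨y, hy, z, hz, h⟩ := Submodule.mem_sup.1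
      (hPQ.sup_eq_top ▸ Submodule.mem_top : x ∈ jointEigenspace B χ ⊔ Q)
    exact ⟨⟨y, hy⟩, z, hz, h.symm⟩
  have hf : f ∈ B := by
    refine hB.mem_of_comm f (LinearMap.ext fun x => ?_) fun e he => LinearMap.ext fun x => ?_
    · obtain ⟨y, z, hz, rfl⟩ := decomp x
      rw [Module.End.mul_apply, map_add, f_Q z hz, add_zero, f_P, f_P]
      simp
    · obtain ⟨y, z, hz, rfl⟩ := decomp x
      rw [Module.End.mul_apply, Module.End.mul_apply, map_add e, map_add f, map_add f,
        f_Q z hz, f_Q _ (hQinv e he z hz), add_zero, add_zero]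
      by_cases hχ : (⟨e, he⟩ : B) ∈ χ
      · rw [(y.2 ⟨e, he⟩).1 hχ, (f_mem y ⟨e, he⟩).1 hχ]
      · rw [(y.2 ⟨e, he⟩).2 hχ, (f_mem y ⟨e, he⟩).2 hχ, map_zero]
  by_cases hχ : (⟨f, hf⟩ : B) ∈ χ
  · right
    refine (Submodule.eq_bot_iff _).2 fun x hx => Subtype.ext ?_
    rw [← (x.2 ⟨f, hf⟩).1 hχ, f_P, (Submodule.projectionOnto_apply_eq_zero_iff hN).2 hx]
    rfl
  · left
    refine (Submodule.eq_bot_iff _).2 fun x hx => Subtype.ext ?_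
    rw [ZeroMemClass.coe_zero, ← (x.2 ⟨f, hf⟩).2 hχ, f_P,
      Submodule.projectionOnto_apply_left hN ⟨x, hx⟩]

end IsMaximalCommutingIdempotents

end CommutingIdempotents

lemma Setup.map_mem_wtSpace (S : Setup K g) {M : Type} [AddCommGroup M] [Module K M]
    [Module (Env K g) M] [IsScalarTower K (Env K g) M] (f : Module.End (Env K g) M)
    {lam : Module.Dual K S.h} {m : M} (hm : m ∈ S.wtSpace M lam) : f m ∈ S.wtSpace M lam := by
  intro H
  rw [← map_smul, hm H]
  exact (f.restrictScalars K).map_smul (lam H) m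

/-- Every object `M` of `O-bar` is a direct sum of indecomposable
objects. -/
theorem exists_indecomposable_direct_sum_decomposition
    (K : Type) [Field K] [IsAlgClosed K] [CharZero K]
    (g : Type) [LieRing g] [LieAlgebra K g] (S : Setup K g) (hDynkin : S.IsDynkin)
    (M : Type) [AddCommGroup M] [Module K M] [Module (Env K g) M]
    [IsScalarTower K (Env K g) M] (hM : S.InO M) :
    ∃ (ι : Type) (N : ι → Submodule (Env K g) M),
      iSupIndep N ∧ (⨆ i, N i) = ⊤ ∧ ∀ i, Indecomposable (K := K) (g := g) (N i) := by
  obtain ⟨B, hB⟩ := exists_isMaximalCommutingIdempotents (Env K g) M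
  have htop : ⨆ χ, jointEigenspace B χ = ⊤ := by
    rw [← Submodule.restrictScalars_eq_top_iff K (Env K g) M, ← top_le_iff, ← hM.span]
    refine iSup_le fun lam => ?_
    have := hM.finite lam
    exact hB.le_iSup_jointEigenspace _ fun e _ v hv => S.map_mem_wtSpace e hv
  refine ⟨{χ : Set B // jointEigenspace B χ ≠ ⊥}, fun χ => jointEigenspace B χ.1,
    hB.iSupIndep_jointEigenspace.comp Subtype.val_injective, ?_, fun χ => ⟨?_, ?_⟩⟩
  · rw [← htop]
    exact iSup_ne_bot_subtype (jointEigenspace B)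
  · have := Submodule.nontrivial_iff_ne_bot.2 χ.2
    exact top_ne_bot
  · exact fun N₁ N₂ hN => hB.eq_bot_or_eq_bot_of_isCompl htop χ.1 hN

end Paper
end
end

section
/- Let g be a root-reductive Lie algebra with splitting maximal toral subalgebra h and Dynkin Borel subalgebra b ⊇ h. Every object of the extended category O-bar admits a decomposition into a direct sum of indecomposable objects that is unique up to isomorphism: if ⨁_{j∈J} M_j = M = ⨁_{j′∈J′} M′_{j′} with all M_j, M′_{j′} indecomposable, then there exists a bijection ψ: J → J′ such that M_j ≅ M′_{ψ(j)} for every j ∈ J. -/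
noncomputable section
namespace Paper

variable (K : Type) [Field K] [IsAlgClosed K] [CharZero K]
variable (g : Type) [LieRing g] [LieAlgebra K g]

variable {K g}

variable {K : Type} [Field K] [IsAlgClosed K] [CharZero K]
variable {g : Type} [LieRing g] [LieAlgebra K g]

section Lattice

variable {ι : Type*} {R : Type*} [Ring R] {M : Type*} [AddCommGroup M] [Module R M]

lemma isCompl_iSup_ne {N : ι → Submodule R M} (hN : iSupIndep N) (hT : (⨆ i, N i) = ⊤) (i : ι) :
    IsCompl (N i) (⨆ (j) (_ : j ≠ i), N j) := by
  refine ⟨hN i, codisjoint_iff.2 (eq_top_iff.2 (hT ▸ iSup_le fun j => ?_))⟩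
  by_cases h : j = i
  · exact h ▸ le_sup_left
  · exact le_sup_of_le_right (le_iSup₂_of_le j h le_rfl)

lemma iSupIndep_of_restrictScalars (K : Type*) [CommRing K] [Algebra K R] [Module K M]
    [IsScalarTower K R M] {N : ι → Submodule R M}
    (hN : iSupIndep fun i => (N i).restrictScalars K) : iSupIndep N := by
  intro i
  have h := hN i
  simp only [← Submodule.restrictScalars_iSup] at h
  rw [Submodule.disjoint_def] at h ⊢
  exact h

/-- The projections onto the summands of a direct sum decomposition. -/
lemma exists_projections {N : ι → Submodule R M} (hN : iSupIndep N) (hT : (⨆ i, N i) = ⊤) :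
    ∃ π : ∀ i, M →ₗ[R] N i, (∀ i (x : N i), π i x = x) ∧
      (∀ i j, i ≠ j → ∀ x : N j, π i x = 0) ∧ (∀ x, {i | π i x ≠ 0}.Finite) ∧
      ∀ x (t : Finset ι), (∀ i ∉ t, π i x = 0) → ∑ i ∈ t, (π i x : M) = x := by
  classical
  have hI := DirectSum.isInternal_submodule_of_iSupIndep_of_iSup_eq_top hN hT
  let e := LinearEquiv.ofBijective (DirectSum.coeLinearMap N) hI
  refine ⟨fun i => DirectSum.component R ι (fun i => N i) i ∘ₗ e.symm.toLinearMap,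
    fun i x => ?_, fun i j hij x => ?_, fun x => ?_, fun x t ht => ?_⟩
  · exact hI.ofBijective_coeLinearMap_same x
  · exact hI.ofBijective_coeLinearMap_of_ne hij.symm x
  · exact (e.symm x).support.finite_toSet.subset fun i hi => (DFinsupp.mem_support_toFun _ _).2 hi
  · have hy : e.symm x = ∑ i ∈ t, DirectSum.lof R ι (fun i => N i) i (e.symm x i) := by
      ext j
      by_cases hj : j ∈ t
      · rw [DFinsupp.finsetSum_apply, Finset.sum_eq_single j]
        · simp [DirectSum.lof_apply]
        · intro i _ hij
          rw [DirectSum.lof_eq_of, DirectSum.of_eq_of_ne _ _ _ hij.symm]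
        · exact fun h => (h hj).elim
      · have h0 : e.symm x j = 0 := ht j hj
        rw [DFinsupp.finsetSum_apply, Finset.sum_eq_zero, h0]
        intro i hi
        rw [DirectSum.lof_eq_of, DirectSum.of_eq_of_ne _ _ _ (fun h => hj (by rwa [h]))]
    have h2 := congrArg e hy
    rw [e.apply_symm_apply, map_sum] at h2
    conv_rhs => rw [h2]
    refine Finset.sum_congr rfl fun i _ => ?_
    exact (DirectSum.coeLinearMap_lof N i _).symm

end Lattice

lemma Indecomposable.nontrivial {X : Type} [AddCommGroup X] [Module (Env K g) X]
    (h : Indecomposable (K := K) (g := g) X) : Nontrivial X :=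
  (Submodule.nontrivial_iff (Env K g)).1 ⟨⟨⊤, ⊥, h.1⟩⟩

namespace Setup

section KrullSchmidt

open Module Module.End

variable (S : Setup K g)

section PointwiseFinite

variable (X Y : Type) [AddCommGroup X] [Module K X] [Module (Env K g) X]
  [IsScalarTower K (Env K g) X] [AddCommGroup Y] [Module K Y] [Module (Env K g) Y]
  [IsScalarTower K (Env K g) Y]

/-- `X` is spanned by its weight spaces, all of which are finite-dimensional. -/
structure PointwiseFinite : Prop where
  span : (⨆ lam : Module.Dual K S.h, S.wtSpace X lam) = ⊤
  finite : ∀ lam : Module.Dual K S.h, FiniteDimensional K (S.wtSpace X lam)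

variable {X Y}

lemma map_mem_wtSpace_s11 (f : X →ₗ[Env K g] Y) {lam : Module.Dual K S.h} {x : X}
    (hx : x ∈ S.wtSpace X lam) : f x ∈ S.wtSpace Y lam := by
  intro H
  rw [← map_smul, hx H, f.map_smul_of_tower]

/-- The map induced on `lam`-weight spaces by a homomorphism. -/
def wtMap (lam : Module.Dual K S.h) :
    (X →ₗ[Env K g] Y) →ₗ[K] (S.wtSpace X lam →ₗ[K] S.wtSpace Y lam) where
  toFun f := (f.restrictScalars K).restrict fun _ hx => S.map_mem_wtSpace_s11 f hx
  map_add' _ _ := rfl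
  map_smul' _ _ := rfl

@[simp]
lemma coe_wtMap (lam : Module.Dual K S.h) (f : X →ₗ[Env K g] Y) (x : S.wtSpace X lam) :
    (S.wtMap lam f x : Y) = f x := rfl

lemma coe_wtMap_sub_pow (lam : Module.Dual K S.h) (f : End (Env K g) X) (c : K) (n : ℕ)
    (x : S.wtSpace X lam) :
    (((S.wtMap lam f - c • 1) ^ n) x : X) = ((f.restrictScalars K - c • 1) ^ n) (x : X) := by
  induction n generalizing x with
  | zero => rfl
  | succ n ih => rw [pow_succ, pow_succ, End.mul_apply, End.mul_apply, ih]; rfl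

lemma PointwiseFinite.exists_ne_bot (hX : S.PointwiseFinite X) [Nontrivial X] :
    ∃ lam, S.wtSpace X lam ≠ ⊥ := by
  by_contra! h
  have := hX.span
  simp only [h, iSup_bot] at this
  exact bot_ne_top this

lemma PointwiseFinite.of_isCompl {M : Type} [AddCommGroup M] [Module K M] [Module (Env K g) M]
    [IsScalarTower K (Env K g) M] (hM : S.PointwiseFinite M) {P Q : Submodule (Env K g) M}
    (h : IsCompl P Q) : S.PointwiseFinite P where
  span := by
    have hs : Function.Surjective (P.projectionOnto Q h) := P.projectionOnto_surjective h
    rw [eq_top_iff]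
    intro y _
    obtain ⟨x, rfl⟩ := hs y
    have hx : x ∈ ⨆ lam : Module.Dual K S.h, S.wtSpace M lam := hM.span ▸ Submodule.mem_top
    have hle : (⨆ lam : Module.Dual K S.h, S.wtSpace M lam) ≤
        (⨆ lam : Module.Dual K S.h, S.wtSpace P lam).comap
          ((P.projectionOnto Q h).restrictScalars K) :=
      iSup_le fun lam x hx =>
        Submodule.mem_iSup_of_mem lam (S.map_mem_wtSpace_s11 (P.projectionOnto Q h) hx)
    exact hle hx
  finite lam := by
    have := hM.finite lam
    exact FiniteDimensional.of_injective (S.wtMap lam P.subtype) fun x y hxy =>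
      Subtype.ext (Subtype.ext (congrArg (fun z : S.wtSpace M lam => (z : M)) hxy))

lemma PointwiseFinite.surjective_of_injective (hX : S.PointwiseFinite X)
    {f : End (Env K g) X} (hf : Function.Injective f) : Function.Surjective f := by
  have hle : (⨆ lam : Module.Dual K S.h, S.wtSpace X lam) ≤
      LinearMap.range (f.restrictScalars K) := by
    refine iSup_le fun lam x hx => ?_
    have := hX.finite lam
    have hinj : Function.Injective (S.wtMap lam f) := fun x y hxy =>
      Subtype.ext (hf (congrArg Subtype.val hxy))
    obtain ⟨y, hy⟩ := LinearMap.surjective_of_injective hinj ⟨x, hx⟩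
    exact ⟨y, congrArg Subtype.val hy⟩
  intro x
  exact hle (hX.span ▸ Submodule.mem_top : x ∈ _)

/-- The simultaneous generalized eigenspace of a family of module endomorphisms, as a
submodule. -/
def simGenEigenspace {ι : Type} (f : ι → End (Env K g) X) (χ : ι → K) :
    Submodule (Env K g) X where
  __ := ⨅ i, maxGenEigenspace ((f i).restrictScalars K) (χ i)
  smul_mem' r x hx := by
    simp only [AddSubsemigroup.mem_carrier, AddSubmonoid.mem_toSubsemigroup,
      Submodule.mem_toAddSubmonoid, Submodule.mem_iInf] at hx ⊢
    intro i
    refine mapsTo_maxGenEigenspace_of_comm (g := Algebra.lsmul K K X r) ?_ _ (hx i)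
    ext y
    exact (f i).map_smul r y

lemma mem_simGenEigenspace {ι : Type} {f : ι → End (Env K g) X} {χ : ι → K} {x : X} :
    x ∈ simGenEigenspace f χ ↔
      ∀ i, ∃ n : ℕ, (((f i).restrictScalars K - χ i • 1) ^ n) x = 0 := by
  change x ∈ (⨅ i, maxGenEigenspace ((f i).restrictScalars K) (χ i)) ↔ _
  simp only [Submodule.mem_iInf, mem_maxGenEigenspace]

lemma commute_restrictScalars {f f' : End (Env K g) X} (h : Commute f f') :
    Commute (f.restrictScalars K) (f'.restrictScalars K) :=
  LinearMap.ext fun x => LinearMap.congr_fun h x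

lemma iSupIndep_simGenEigenspace {ι : Type} {f : ι → End (Env K g) X}
    (hf : ∀ i j, Commute (f i) (f j)) : iSupIndep (simGenEigenspace f) :=
  iSupIndep_of_restrictScalars K
    (independent_iInf_maxGenEigenspace_of_forall_mapsTo (fun i => (f i).restrictScalars K)
      fun i j φ => mapsTo_maxGenEigenspace_of_comm (commute_restrictScalars (hf j i)) φ)

lemma PointwiseFinite.iSup_simGenEigenspace (hX : S.PointwiseFinite X) {ι : Type}
    {f : ι → End (Env K g) X} (hf : ∀ i j, Commute (f i) (f j)) :
    (⨆ χ, simGenEigenspace f χ) = ⊤ := by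
  rw [← Submodule.restrictScalars_eq_top_iff K, eq_top_iff, ← hX.span,
    Submodule.restrictScalars_iSup]
  refine iSup_le fun lam => ?_
  have := hX.finite lam
  have hc : ∀ i j, Commute (S.wtMap lam (f i)) (S.wtMap lam (f j)) := fun i j =>
    congrArg (S.wtMap lam) (hf i j)
  have htop := iSup_iInf_maxGenEigenspace_eq_top_of_forall_mapsTo
    (fun i => (S.wtMap lam (f i) : End K (S.wtSpace X lam)))
    (fun i j φ => mapsTo_maxGenEigenspace_of_comm (hc j i) φ)
    (fun i => iSup_maxGenEigenspace_eq_top _)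
  rw [← (S.wtSpace X lam).map_subtype_top, ← htop, Submodule.map_iSup]
  refine iSup_mono fun χ => ?_
  rintro _ ⟨x, hx, rfl⟩
  refine mem_simGenEigenspace.2 fun i => ?_
  have hx' := (Submodule.mem_iInf _).1 hx i
  obtain ⟨n, hn⟩ := (mem_maxGenEigenspace _ _ _).1 hx'
  exact ⟨n, by rw [Submodule.coe_subtype, ← coe_wtMap_sub_pow, hn]; rfl⟩

/-- An endomorphism of an indecomposable module has exactly one generalized eigenvalue. -/
lemma PointwiseFinite.exists_forall_pow (hX : S.PointwiseFinite X)
    (hI : Indecomposable (K := K) (g := g) X) (f : End (Env K g) X) :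
    ∃ c : K, ∀ x : X, ∃ n : ℕ, ((f.restrictScalars K - c • 1) ^ n) x = 0 := by
  have hf : ∀ i j : Unit, Commute ((fun _ : Unit => f) i) ((fun _ : Unit => f) j) :=
    fun _ _ => Commute.refl f
  have hT := hX.iSup_simGenEigenspace S hf
  obtain ⟨χ, hχ⟩ : ∃ χ, simGenEigenspace (K := K) (fun _ : Unit => f) χ ≠ ⊥ := by
    by_contra! h
    exact hI.1 (by rw [← hT]; simp [h])
  have hc := isCompl_iSup_ne (iSupIndep_simGenEigenspace hf) hT χ
  have htop : simGenEigenspace (K := K) (fun _ : Unit => f) χ = ⊤ :=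
    eq_top_of_isCompl_bot (((hI.2 _ _ hc).resolve_left hχ) ▸ hc)
  exact ⟨χ (), fun x => mem_simGenEigenspace.1 (htop ▸ Submodule.mem_top : x ∈ _) ()⟩

lemma sub_smul_pow_apply {f : End K X} {a : K} {x : X} (h : f x = a • x) (c : K) (n : ℕ) :
    ((f - c • 1) ^ n) x = (a - c) ^ n • x := by
  induction n with
  | zero => simp
  | succ n ih =>
    have h1 : (f - c • 1) x = (a - c) • x := by simp [h, sub_smul]
    rw [pow_succ, End.mul_apply, h1, map_smul, ih, smul_smul, pow_succ']

lemma injective_of_forall_pow {f : End (Env K g) X} {c : K} (hc : c ≠ 0)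
    (h : ∀ x : X, ∃ n : ℕ, ((f.restrictScalars K - c • 1) ^ n) x = 0) :
    Function.Injective f := by
  refine (injective_iff_map_eq_zero f).2 fun x hx => ?_
  obtain ⟨n, hn⟩ := h x
  have hx' : f.restrictScalars K x = (0 : K) • x := by simpa using hx
  rw [sub_smul_pow_apply hx'] at hn
  exact (smul_eq_zero.1 hn).resolve_left (pow_ne_zero _ (by simpa using hc))

lemma smul_eq_of_isIdempotentElem {e : End (Env K g) X} (he : IsIdempotentElem e) {c : K} {x : X}
    (hx : ∃ n : ℕ, ((e.restrictScalars K - c • 1) ^ n) x = 0) : e x = c • x := by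
  obtain ⟨n, hn⟩ := hx
  have hee : e (e x) = e x := LinearMap.congr_fun he x
  have h1 : e.restrictScalars K (e x) = (1 : K) • e x := by simpa using hee
  have h0 : e.restrictScalars K (x - e x) = (0 : K) • (x - e x) := by simp [hee]
  have hdec : ((e.restrictScalars K - c • 1) ^ n) x =
      (1 - c) ^ n • e x + (0 - c) ^ n • (x - e x) := by
    rw [← sub_smul_pow_apply h1, ← sub_smul_pow_apply h0, ← map_add, add_sub_cancel]
  rw [hn] at hdec
  have e1 := congrArg e hdec
  rw [map_zero, map_add, e.map_smul_of_tower, e.map_smul_of_tower, map_sub, hee, sub_self,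
    smul_zero, add_zero] at e1
  rw [← e1, zero_add] at hdec
  rcases smul_eq_zero.1 e1.symm with h | h
  · rw [← sub_eq_zero.1 (eq_zero_of_pow_eq_zero h)] at hdec ⊢
    rcases smul_eq_zero.1 hdec.symm with h' | h'
    · simp at h'
    · rw [one_smul, ← sub_eq_zero.1 h']
  · rcases smul_eq_zero.1 hdec.symm with h' | h'
    · have : c = 0 := by simpa using eq_zero_of_pow_eq_zero h'
      rw [h, this, zero_smul]
    · rw [h, sub_zero] at h'
      rw [h', map_zero, smul_zero]

/-- The trace of an endomorphism on the `lam`-weight space. -/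
def wtTrace (lam : Module.Dual K S.h) : End (Env K g) X →ₗ[K] K :=
  LinearMap.trace K (S.wtSpace X lam) ∘ₗ S.wtMap lam

lemma wtTrace_one (lam : Module.Dual K S.h) [FiniteDimensional K (S.wtSpace X lam)] :
    S.wtTrace lam (1 : End (Env K g) X) = finrank K (S.wtSpace X lam) :=
  LinearMap.trace_one K _

lemma wtTrace_mul_comm (lam : Module.Dual K S.h) (f f' : End (Env K g) X) :
    S.wtTrace lam (f * f') = S.wtTrace lam (f' * f) :=
  LinearMap.trace_mul_comm K (S.wtMap lam f) (S.wtMap lam f')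

lemma wtTrace_eq_of_forall_pow (lam : Module.Dual K S.h)
    [FiniteDimensional K (S.wtSpace X lam)] {f : End (Env K g) X} {c : K}
    (h : ∀ x : X, ∃ n : ℕ, ((f.restrictScalars K - c • 1) ^ n) x = 0) :
    S.wtTrace lam f = c * finrank K (S.wtSpace X lam) := by
  have hn : IsNilpotent (S.wtMap lam f - c • 1 : End K (S.wtSpace X lam)) := by
    refine Module.End.isNilpotent_iff_of_finite.2 fun x => ?_
    obtain ⟨n, hn⟩ := h x
    exact ⟨n, Subtype.ext ((S.coe_wtMap_sub_pow lam f c n x).trans hn)⟩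
  have h0 := (LinearMap.isNilpotent_trace_of_isNilpotent hn).eq_zero
  rw [map_sub, map_smul, LinearMap.trace_one, sub_eq_zero] at h0
  exact h0

lemma PointwiseFinite.bijective_of_wtTrace_ne_zero (hX : S.PointwiseFinite X)
    (hI : Indecomposable (K := K) (g := g) X) {lam : Module.Dual K S.h} {f : End (Env K g) X}
    (hf : S.wtTrace lam f ≠ 0) : Function.Bijective f := by
  have := hX.finite lam
  obtain ⟨c, hc⟩ := hX.exists_forall_pow S hI f
  have hc0 : c ≠ 0 := by
    rintro rfl
    exact hf (by rw [S.wtTrace_eq_of_forall_pow lam hc, zero_mul])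
  have hinj := injective_of_forall_pow hc0 hc
  exact ⟨hinj, hX.surjective_of_injective S hinj⟩

/-- Normalized by the dimension of the weight space, the trace is multiplicative on the
endomorphism ring of an indecomposable module. -/
lemma PointwiseFinite.wtTrace_mul (hX : S.PointwiseFinite X)
    (hI : Indecomposable (K := K) (g := g) X) (lam : Module.Dual K S.h)
    (f f' : End (Env K g) X) :
    finrank K (S.wtSpace X lam) * S.wtTrace lam (f * f') =
      S.wtTrace lam f * S.wtTrace lam f' := by
  have := hX.finite lam
  have := Indecomposable.nontrivial hI
  obtain ⟨c, hc⟩ := hX.exists_forall_pow S hI f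
  have h0 : S.wtTrace lam (f' * (f - c • 1)) = 0 := by
    by_contra h
    have hinj : Function.Injective (f - c • 1 : End (Env K g) X) :=
      Function.Injective.of_comp (f := f')
        (hX.bijective_of_wtTrace_ne_zero S hI h).injective
    obtain ⟨x, hx⟩ := exists_ne (0 : X)
    obtain ⟨n, hn⟩ := hc x
    have hp : ∀ y, ((f.restrictScalars K - c • 1) ^ n) y = 0 → y = 0 := by
      clear hn
      induction n with
      | zero => exact fun y hy => hy
      | succ n ih =>
        intro y hy
        rw [pow_succ, End.mul_apply] at hy
        exact (injective_iff_map_eq_zero _).1 hinj y (ih _ hy)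
    exact hx (hp x hn)
  rw [mul_sub, map_sub, sub_eq_zero, mul_smul_comm, mul_one, map_smul,
    S.wtTrace_mul_comm] at h0
  rw [h0, S.wtTrace_eq_of_forall_pow lam hc, smul_eq_mul]
  ring

/-- An endomorphism of an indecomposable `X` with nonzero trace on a weight space cannot factor
through an indecomposable module that is not isomorphic to `X`. -/
lemma PointwiseFinite.nonempty_equiv_of_wtTrace_ne_zero (hX : S.PointwiseFinite X)
    (hI : Indecomposable (K := K) (g := g) X) (hY : Indecomposable (K := K) (g := g) Y)
    {lam : Module.Dual K S.h} (a : Y →ₗ[Env K g] X) (b : X →ₗ[Env K g] Y)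
    (h : S.wtTrace lam (a ∘ₗ b) ≠ 0) : Nonempty (X ≃ₗ[Env K g] Y) := by
  have := Indecomposable.nontrivial hI
  have hb := hX.bijective_of_wtTrace_ne_zero S hI h
  have hbinj : Function.Injective b := Function.Injective.of_comp (f := a) hb.injective
  have hc : IsCompl (LinearMap.range b) (LinearMap.ker a) := by
    refine ⟨Submodule.disjoint_def.2 ?_, codisjoint_iff.2 (eq_top_iff.2 fun y _ => ?_)⟩
    · rintro _ ⟨x, rfl⟩ hx
      rw [(injective_iff_map_eq_zero _).1 hb.injective x hx, map_zero]
    · obtain ⟨x, hx⟩ := hb.surjective (a y)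
      rw [← add_sub_cancel (b x) y]
      refine Submodule.add_mem_sup ⟨x, rfl⟩ ?_
      rw [LinearMap.mem_ker, map_sub, sub_eq_zero]
      exact hx.symm
  rcases hY.2 _ _ hc with h1 | h1
  · obtain ⟨x, hx⟩ := exists_ne (0 : X)
    have : b x ∈ LinearMap.range b := ⟨x, rfl⟩
    rw [h1, Submodule.mem_bot] at this
    exact (hx (hbinj (this.trans (map_zero b).symm))).elim
  · exact ⟨LinearEquiv.ofBijective b
      ⟨hbinj, LinearMap.range_eq_top.1 (eq_top_of_isCompl_bot (h1 ▸ hc))⟩⟩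

end PointwiseFinite

section Decomposition

variable {M : Type} [AddCommGroup M] [Module K M] [Module (Env K g) M]
  [IsScalarTower K (Env K g) M]

/-- Only finitely many summands of a decomposition contribute to a given weight space. -/
lemma PointwiseFinite.exists_finset (hM : S.PointwiseFinite M) {ι : Type}
    {N : ι → Submodule (Env K g) M} {π : ∀ i, M →ₗ[Env K g] N i}
    (hfin : ∀ x, {i | π i x ≠ 0}.Finite) (lam : Module.Dual K S.h) :
    ∃ t : Finset ι, ∀ i ∉ t, ∀ x ∈ S.wtSpace M lam, π i x = 0 := by
  have := hM.finite lam
  let B := Module.finBasis K (S.wtSpace M lam)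
  have hfin' : (⋃ k, {i | π i (B k : M) ≠ 0}).Finite := Set.finite_iUnion fun k => hfin _
  refine ⟨hfin'.toFinset, fun i hi x hx => ?_⟩
  have hi' : ∀ k, π i (B k : M) = 0 := by simpa using hi
  have h0 : ((π i).restrictScalars K) ∘ₗ (S.wtSpace M lam).subtype = 0 :=
    B.ext fun k => hi' k
  exact LinearMap.congr_fun h0 ⟨x, hx⟩

lemma PointwiseFinite.finite_setOf_equiv (hM : S.PointwiseFinite M) {ι : Type}
    {N : ι → Submodule (Env K g) M} (hN : iSupIndep N) (hT : (⨆ i, N i) = ⊤)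
    {X : Type} [AddCommGroup X] [Module K X] [Module (Env K g) X]
    [IsScalarTower K (Env K g) X] (hX : S.PointwiseFinite X) [Nontrivial X] :
    {i | Nonempty (X ≃ₗ[Env K g] N i)}.Finite := by
  obtain ⟨π, hπ, -, hfin, -⟩ := exists_projections hN hT
  obtain ⟨lam, hlam⟩ := hX.exists_ne_bot S
  obtain ⟨t, ht⟩ := hM.exists_finset S hfin lam
  refine t.finite_toSet.subset fun i ⟨e⟩ => ?_
  by_contra hi
  obtain ⟨x, hx, hx0⟩ := (Submodule.ne_bot_iff _).1 hlam
  have h := ht i hi (e x) (S.map_mem_wtSpace_s11 ((N i).subtype ∘ₗ e.toLinearMap) hx)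
  rw [hπ] at h
  exact hx0 (e.map_eq_zero_iff.1 h)

/-- The multiplicity of an indecomposable module in one decomposition into indecomposables is at
most its multiplicity in any other. -/
lemma PointwiseFinite.card_le_card (hM : S.PointwiseFinite M) {ι ι' : Type}
    {N : ι → Submodule (Env K g) M} (hN : iSupIndep N) (hT : (⨆ i, N i) = ⊤)
    {N' : ι' → Submodule (Env K g) M} (hN' : iSupIndep N') (hT' : (⨆ i, N' i) = ⊤)
    (hI' : ∀ i, Indecomposable (K := K) (g := g) (N' i))
    {X : Type} [AddCommGroup X] [Module K X] [Module (Env K g) X]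
    [IsScalarTower K (Env K g) X] (hX : S.PointwiseFinite X)
    (hI : Indecomposable (K := K) (g := g) X) :
    Nat.card {i // Nonempty (X ≃ₗ[Env K g] N i)} ≤
      Nat.card {i // Nonempty (X ≃ₗ[Env K g] N' i)} := by
  classical
  have := Indecomposable.nontrivial hI
  have hF := hM.finite_setOf_equiv S hN hT hX
  have hF' := hM.finite_setOf_equiv S hN' hT' hX
  have : Fintype {i // Nonempty (X ≃ₗ[Env K g] N i)} := hF.fintype
  have : Fintype {i // Nonempty (X ≃ₗ[Env K g] N' i)} := hF'.fintype
  obtain ⟨π, hπ, hπ0, -, -⟩ := exists_projections hN hT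
  obtain ⟨π', -, -, hfin', hsum'⟩ := exists_projections hN' hT'
  obtain ⟨lam, hlam⟩ := hX.exists_ne_bot S
  have := hX.finite lam
  have hd : (finrank K (S.wtSpace X lam) : K) ≠ 0 := by
    have : Nontrivial (S.wtSpace X lam) := Submodule.nontrivial_iff_ne_bot.2 hlam
    exact Nat.cast_ne_zero.2 finrank_pos.ne'
  obtain ⟨t, ht⟩ := hM.exists_finset S hfin' lam
  let θ (i : {i // Nonempty (X ≃ₗ[Env K g] N i)}) : X ≃ₗ[Env K g] N i := i.2.some
  let θ' (i : {i // Nonempty (X ≃ₗ[Env K g] N' i)}) : X ≃ₗ[Env K g] N' i := i.2.some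
  let a (k : {i // Nonempty (X ≃ₗ[Env K g] N i)}) (j : ι') : N' j →ₗ[Env K g] X :=
    (θ k).symm.toLinearMap ∘ₗ π k ∘ₗ (N' j).subtype
  let b (j : ι') (i : {i // Nonempty (X ≃ₗ[Env K g] N i)}) : X →ₗ[Env K g] N' j :=
    π' j ∘ₗ (N i).subtype ∘ₗ (θ i).toLinearMap
  let A : Matrix {i // Nonempty (X ≃ₗ[Env K g] N i)} {i // Nonempty (X ≃ₗ[Env K g] N' i)} K :=
    fun k j => S.wtTrace lam (a k j ∘ₗ (θ' j).toLinearMap)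
  let B : Matrix {i // Nonempty (X ≃ₗ[Env K g] N' i)} {i // Nonempty (X ≃ₗ[Env K g] N i)} K :=
    fun j i => S.wtTrace lam ((θ' j).symm.toLinearMap ∘ₗ b j i)
  have hAB : A * B = ((finrank K (S.wtSpace X lam) : K) * finrank K (S.wtSpace X lam)) • 1 := by
    ext k i
    have h1 : S.wtTrace lam ((θ k).symm.toLinearMap ∘ₗ π k ∘ₗ (N i).subtype ∘ₗ
        (θ i).toLinearMap) = finrank K (S.wtSpace X lam) * (1 : Matrix _ _ K) k i := by
      by_cases hki : k = i
      · subst hki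
        rw [Matrix.one_apply_eq, mul_one, ← S.wtTrace_one lam]
        congr 1
        ext x
        simp [hπ]
      · rw [Matrix.one_apply_ne hki, mul_zero, ← map_zero (S.wtTrace (X := X) lam)]
        congr 1
        ext x
        simp [hπ0 k i (fun h => hki (Subtype.ext h))]
    have h2 : S.wtTrace lam ((θ k).symm.toLinearMap ∘ₗ π k ∘ₗ (N i).subtype ∘ₗ
        (θ i).toLinearMap) = ∑ j ∈ t, S.wtTrace lam (a k j ∘ₗ b j i) := by
      rw [← map_sum]
      refine congrArg (LinearMap.trace K _) (LinearMap.ext fun x => Subtype.ext ?_)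
      have hy : (θ i x : M) ∈ S.wtSpace M lam :=
        S.map_mem_wtSpace_s11 ((N i).subtype ∘ₗ (θ i).toLinearMap) x.2
      have hs := hsum' (θ i x : M) t fun j hj => ht j hj _ hy
      simp only [coe_wtMap, LinearMap.sum_apply, LinearMap.comp_apply, a, b,
        Submodule.subtype_apply, LinearEquiv.coe_coe]
      conv_lhs => rw [← hs]
      simp only [map_sum]
    have h3 : ∑ j ∈ t, S.wtTrace lam (a k j ∘ₗ b j i) =
        ∑ j : {i // Nonempty (X ≃ₗ[Env K g] N' i)}, S.wtTrace lam (a k j ∘ₗ b j i) := by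
      rw [← Finset.sum_subtype hF'.toFinset (fun j => by simp)
        (fun j => S.wtTrace lam (a k j ∘ₗ b j i))]
      refine (Finset.sum_subset (Finset.subset_union_left (s₂ := hF'.toFinset)) ?_).trans
        (Finset.sum_subset Finset.subset_union_right ?_).symm
      · intro j _ hj
        rw [← map_zero (S.wtTrace (X := X) lam)]
        refine congrArg (LinearMap.trace K _) (LinearMap.ext fun x => Subtype.ext ?_)
        have hy : (θ i x : M) ∈ S.wtSpace M lam :=
          S.map_mem_wtSpace_s11 ((N i).subtype ∘ₗ (θ i).toLinearMap) x.2
        simp [a, b, ht j hj _ hy]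
      · intro j _ hj
        by_contra h0
        exact hj (by simpa using hX.nonempty_equiv_of_wtTrace_ne_zero S hI (hI' j) _ _ h0)
    rw [Matrix.mul_apply, Matrix.smul_apply, smul_eq_mul, mul_assoc, ← h1, h2, h3,
      Finset.mul_sum]
    refine Finset.sum_congr rfl fun j _ => ?_
    rw [← hX.wtTrace_mul S hI lam]
    congr 2
    ext x
    simp
  have hr : (A * B).rank = Fintype.card {i // Nonempty (X ≃ₗ[Env K g] N i)} := by
    rw [hAB, ← Algebra.algebraMap_eq_smul_one]
    exact Matrix.rank_of_isUnit _ ((IsUnit.mk0 _ (mul_ne_zero hd hd)).map (algebraMap K _))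
  rw [Nat.card_eq_fintype_card, Nat.card_eq_fintype_card, ← hr]
  exact (Matrix.rank_mul_le_left A B).trans (Matrix.rank_le_card_width A)

/-- Uniqueness of decompositions into indecomposables. -/
lemma PointwiseFinite.exists_equiv (hM : S.PointwiseFinite M) {ι ι' : Type}
    {N : ι → Submodule (Env K g) M} (hN : iSupIndep N) (hT : (⨆ i, N i) = ⊤)
    (hI : ∀ i, Indecomposable (K := K) (g := g) (N i))
    {N' : ι' → Submodule (Env K g) M} (hN' : iSupIndep N') (hT' : (⨆ i, N' i) = ⊤)
    (hI' : ∀ i, Indecomposable (K := K) (g := g) (N' i)) :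
    ∃ ψ : ι ≃ ι', ∀ i, Nonempty (N i ≃ₗ[Env K g] N' (ψ i)) := by
  let r : Setoid (Submodule (Env K g) M) :=
    { r := fun P Q => Nonempty (P ≃ₗ[Env K g] Q)
      iseqv := ⟨fun P => ⟨LinearEquiv.refl _ P⟩, fun ⟨e⟩ => ⟨e.symm⟩,
        fun ⟨e⟩ ⟨e'⟩ => ⟨e.trans e'⟩⟩ }
  let p (i : ι) : Quotient r := ⟦N i⟧
  let p' (i : ι') : Quotient r := ⟦N' i⟧
  have key (P : Submodule (Env K g) M) (hP : S.PointwiseFinite P)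
      (hPI : Indecomposable (K := K) (g := g) P) :
      Nonempty ({i // p i = ⟦P⟧} ≃ {i // p' i = ⟦P⟧}) := by
    have := Indecomposable.nontrivial hPI
    have e : {i // p i = ⟦P⟧} ≃ {i // Nonempty (P ≃ₗ[Env K g] N i)} :=
      Equiv.subtypeEquivRight fun i => eq_comm.trans Quotient.eq
    have e' : {i // p' i = ⟦P⟧} ≃ {i // Nonempty (P ≃ₗ[Env K g] N' i)} :=
      Equiv.subtypeEquivRight fun i => eq_comm.trans Quotient.eq
    have : Finite {i // Nonempty (P ≃ₗ[Env K g] N i)} := hM.finite_setOf_equiv S hN hT hP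
    have : Finite {i // Nonempty (P ≃ₗ[Env K g] N' i)} := hM.finite_setOf_equiv S hN' hT' hP
    have hcard := (hM.card_le_card S hN hT hN' hT' hI' hP hPI).antisymm
      (hM.card_le_card S hN' hT' hN hT hI hP hPI)
    exact (Finite.card_eq.1 hcard).map fun e₀ => e.trans (e₀.trans e'.symm)
  have hq (q : Quotient r) : Nonempty ({i // p i = q} ≃ {i // p' i = q}) := by
    by_cases h : ∃ i, p i = q
    · obtain ⟨i, rfl⟩ := h
      exact key (N i) (hM.of_isCompl S (isCompl_iSup_ne hN hT i)) (hI i)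
    by_cases h' : ∃ i, p' i = q
    · obtain ⟨i, rfl⟩ := h'
      exact key (N' i) (hM.of_isCompl S (isCompl_iSup_ne hN' hT' i)) (hI' i)
    have : IsEmpty {i // p i = q} := ⟨fun i => h ⟨i, i.2⟩⟩
    have : IsEmpty {i // p' i = q} := ⟨fun i => h' ⟨i, i.2⟩⟩
    exact ⟨Equiv.equivOfIsEmpty _ _⟩
  let e (q : Quotient r) : {i // p i = q} ≃ {i // p' i = q} := (hq q).some
  let ψ := ((Equiv.sigmaFiberEquiv p).symm.trans (Equiv.sigmaCongrRight e)).trans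
    (Equiv.sigmaFiberEquiv p')
  exact ⟨ψ, fun i => Quotient.exact (e (p i) ⟨i, rfl⟩).2.symm⟩

/-- A maximal set of pairwise commuting idempotent endomorphisms exists. -/
lemma exists_maximal_commuting_idempotents (A : Type*) [Monoid A] :
    ∃ E : Set A, (∀ e ∈ E, IsIdempotentElem e) ∧ (∀ e ∈ E, ∀ f ∈ E, Commute e f) ∧
      ∀ p, IsIdempotentElem p → (∀ e ∈ E, Commute p e) → p ∈ E := by
  obtain ⟨E, hE⟩ : ∃ E, Maximal
      (· ∈ {E : Set A | (∀ e ∈ E, IsIdempotentElem e) ∧ ∀ e ∈ E, ∀ f ∈ E, Commute e f}) E := by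
    refine zorn_subset _ fun c hc hchain =>
      ⟨⋃₀ c, ⟨?_, ?_⟩, fun s hs => Set.subset_sUnion_of_mem hs⟩
    · rintro e ⟨s, hs, he⟩
      exact (hc hs).1 e he
    · rintro e ⟨s, hs, he⟩ f ⟨s', hs', hf⟩
      rcases hchain.total hs hs' with h | h
      exacts [(hc hs').2 e (h he) f hf, (hc hs).2 e he f (h hf)]
  refine ⟨E, hE.prop.1, hE.prop.2, fun p hp hc => ?_⟩
  refine hE.le_of_ge (y := insert p E) ⟨?_, ?_⟩ (Set.subset_insert p E) (Set.mem_insert p E)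
  · rintro e (rfl | he)
    exacts [hp, hE.prop.1 e he]
  · rintro e (rfl | he) f (rfl | hf)
    exacts [Commute.refl _, hc f hf, (hc e he).symm, hE.prop.2 e he f hf]

/-- Existence of decompositions into indecomposables. -/
lemma PointwiseFinite.exists_decomposition (hM : S.PointwiseFinite M) :
    ∃ (ι : Type) (N : ι → Submodule (Env K g) M),
      iSupIndep N ∧ (⨆ i, N i) = ⊤ ∧ ∀ i, Indecomposable (K := K) (g := g) (N i) := by
  obtain ⟨E, hE, hEc, hmax⟩ := exists_maximal_commuting_idempotents (End (Env K g) M)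
  let N : (E → K) → Submodule (Env K g) M := simGenEigenspace fun e : E => (e : End (Env K g) M)
  have hc : ∀ e f : E, Commute (e : End (Env K g) M) f := fun e f => hEc e e.2 f f.2
  have hN : iSupIndep N := iSupIndep_simGenEigenspace hc
  have hT : (⨆ χ, N χ) = ⊤ := hM.iSup_simGenEigenspace S hc
  have hsmul (χ : E → K) (e : E) {x : M} (hx : x ∈ N χ) : (e : End (Env K g) M) x = χ e • x :=
    smul_eq_of_isIdempotentElem (hE e e.2) (mem_simGenEigenspace.1 hx e)
  refine ⟨{χ // N χ ≠ ⊥}, fun χ => N χ, hN.comp Subtype.val_injective,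
    (iSup_ne_bot_subtype N).trans hT, fun ⟨χ, hχ⟩ => ⟨?_, fun N₁ N₂ h => ?_⟩⟩
  · exact fun h => hχ (Submodule.subsingleton_iff_eq_bot.1
      ((Submodule.subsingleton_iff (Env K g)).1 (subsingleton_of_bot_eq_top h.symm)))
  · let A := N₁.map (N χ).subtype
    let B := N₂.map (N χ).subtype
    have hAB : A ⊔ B = N χ := by
      rw [← Submodule.map_sup, h.sup_eq_top, Submodule.map_subtype_top]
    have hdis : Disjoint A B :=
      (Submodule.disjoint_map (N χ).injective_subtype h.disjoint)
    have hcompl : IsCompl A (B ⊔ ⨆ (χ') (_ : χ' ≠ χ), N χ') :=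
      Disjoint.isCompl_sup_right_of_isCompl_sup_left hdis (hAB ▸ isCompl_iSup_ne hN hT χ)
    have hAle : A ≤ N χ := hAB ▸ le_sup_left
    have hBle : B ≤ N χ := hAB ▸ le_sup_right
    let p : End (Env K g) M := A.projection _ hcompl
    have hinv (e : E) (P : Submodule (Env K g) M) (χ' : E → K) (hP : P ≤ N χ') :
        P ≤ P.comap (e : End (Env K g) M) := fun x hx => by
      rw [Submodule.mem_comap, hsmul χ' e (hP hx), ← algebraMap_smul (Env K g)]
      exact P.smul_mem _ hx
    have hp : p ∈ E := by
      refine hmax p (Submodule.isIdempotentElem_projection hcompl) fun e he => ?_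
      have hQ : (B ⊔ ⨆ (χ') (_ : χ' ≠ χ), N χ') ≤
          (B ⊔ ⨆ (χ') (_ : χ' ≠ χ), N χ').comap e :=
        sup_le ((hinv ⟨e, he⟩ B χ hBle).trans (Submodule.comap_mono le_sup_left))
          (iSup₂_le fun χ' h' => (hinv ⟨e, he⟩ _ χ' le_rfl).trans
            (Submodule.comap_mono (le_sup_of_le_right (le_iSup₂_of_le χ' h' le_rfl))))
      refine LinearMap.ext fun x => ?_
      obtain ⟨a, ha, q, hq, rfl⟩ :=
        Submodule.mem_sup.1 (hcompl.sup_eq_top ▸ Submodule.mem_top : x ∈ A ⊔ _)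
      rw [End.mul_apply, End.mul_apply, map_add, map_add, map_add,
        Submodule.projection_apply_of_mem_left hcompl ha,
        Submodule.projection_apply_of_mem_left hcompl (hinv ⟨e, he⟩ A χ hAle ha),
        (Submodule.projection_apply_eq_zero_iff hcompl).2 hq,
        (Submodule.projection_apply_eq_zero_iff hcompl).2 (hQ hq), map_add, map_zero]
    by_contra! hne
    obtain ⟨a, ha, ha0⟩ := (Submodule.ne_bot_iff _).1 hne.1
    obtain ⟨b, hb, hb0⟩ := (Submodule.ne_bot_iff _).1 hne.2
    have ha1 : p (a : M) = χ ⟨p, hp⟩ • (a : M) := hsmul χ ⟨p, hp⟩ a.2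
    have hb1 : p (b : M) = χ ⟨p, hp⟩ • (b : M) := hsmul χ ⟨p, hp⟩ b.2
    have ha2 : p (a : M) = a := Submodule.projection_apply_of_mem_left hcompl ⟨a, ha, rfl⟩
    have hb2 : p (b : M) = 0 := (Submodule.projection_apply_eq_zero_iff hcompl).2
      (Submodule.mem_sup_left ⟨b, hb, rfl⟩)
    rw [hb2] at hb1
    have h0 := (smul_eq_zero.1 hb1.symm).resolve_right fun h => hb0 (Subtype.ext h)
    rw [ha2, h0, zero_smul] at ha1
    exact ha0 (Subtype.ext ha1)

end Decomposition

end KrullSchmidt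

end Setup

/-- Every object of `O-bar` admits a decomposition into a direct sum of
indecomposable objects, unique up to isomorphism. -/
theorem krull_schmidt_for_obar
    (K : Type) [Field K] [IsAlgClosed K] [CharZero K]
    (g : Type) [LieRing g] [LieAlgebra K g] (S : Setup K g) (hDynkin : S.IsDynkin)
    (M : Type) [AddCommGroup M] [Module K M] [Module (Env K g) M]
    [IsScalarTower K (Env K g) M] (hM : S.InO M) :
    (∃ (ι : Type) (N : ι → Submodule (Env K g) M),
      iSupIndep N ∧ (⨆ i, N i) = ⊤ ∧ ∀ i, Indecomposable (K := K) (g := g) (N i)) ∧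
    (∀ (ι ι' : Type) (N : ι → Submodule (Env K g) M) (N' : ι' → Submodule (Env K g) M),
      iSupIndep N → (⨆ i, N i) = ⊤ → (∀ i, Indecomposable (K := K) (g := g) (N i)) →
      iSupIndep N' → (⨆ i', N' i') = ⊤ → (∀ i', Indecomposable (K := K) (g := g) (N' i')) →
      ∃ ψ : ι ≃ ι', ∀ i, Nonempty ((N i) ≃ₗ[Env K g] (N' (ψ i)))) := by
  have hP : S.PointwiseFinite M := ⟨hM.span, hM.finite⟩
  exact ⟨hP.exists_decomposition S, fun _ _ _ _ hN hT hI hN' hT' hI' =>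
    hP.exists_equiv S hN hT hI hN' hT' hI'⟩

end Paper
end
end
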